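/- Let η ∈ (0,1/4), m ∈ {0,…,n−2}, and let D_{η,m} be the complement of the parabolic cone. Then D_{η,m} is parabolically accessible with constants N = 4, δ_0 = 1/2, and a constant c_0 > 0 depending only on the dimension n (in particular, the constants do not depend on η). -/

import Mathlib

open Metric Set MeasureTheory Filter

noncomputable section

/-- The parabolic cylinder `Q_r(x₀,t₀) = B_r(x₀) × (t₀ - r², t₀)`. -/
def pcylinder (n : ℕ) (r : ℝ) (x₀ : EuclideanSpace ℝ (Fin n)) (t₀ : ℝ) :
    Set (EuclideanSpace ℝ (Fin n) × ℝ) :=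
  (Metric.ball x₀ r) ×ˢ (Set.Ioo (t₀ - r ^ 2) t₀)

/-- `Q_r = Q_r(0,0)`. -/
def Q (n : ℕ) (r : ℝ) : Set (EuclideanSpace ℝ (Fin n) × ℝ) :=
  pcylinder n r 0 0

/-- The spatial Laplacian of `u(·,t)` at `(x,t)`. -/
def slap {n : ℕ} (u : EuclideanSpace ℝ (Fin n) → ℝ → ℝ)
    (x : EuclideanSpace ℝ (Fin n)) (t : ℝ) : ℝ :=
  ∑ i : Fin n,
    fderiv ℝ (fun y => fderiv ℝ (fun z => u z t) y (EuclideanSpace.single i (1:ℝ))) x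
      (EuclideanSpace.single i (1:ℝ))

/-- The parabolic distance `d_p((x,t),(y,s)) = (|x-y|² + |t-s|)^{1/2}`. -/
def pdist {n : ℕ} (p q : EuclideanSpace ℝ (Fin n) × ℝ) : ℝ :=
  Real.sqrt (‖p.1 - q.1‖ ^ 2 + |p.2 - q.2|)

/-- `Ω_r = {p ∈ Ω : d_p(p, ∂Ω) ≥ r}`. -/
def pint {n : ℕ} (Ω : Set (EuclideanSpace ℝ (Fin n) × ℝ)) (r : ℝ) :
    Set (EuclideanSpace ℝ (Fin n) × ℝ) :=
  {p ∈ Ω | ∀ q ∈ frontier Ω, r ≤ pdist p q}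

/-- The natural `n`-dimensional surface measure on the parabolic boundary of the cylinder
`Q_r(x₀,t₀)`: Lebesgue measure on the bottom `B_r(x₀) × {t₀ - r²}` plus surface measure
(`(n-1)`-Hausdorff on the sphere times length in time) on the lateral boundary. -/
def pbSurfaceMeasureCyl (n : ℕ) (r : ℝ) (x₀ : EuclideanSpace ℝ (Fin n)) (t₀ : ℝ) :
    Measure (EuclideanSpace ℝ (Fin n) × ℝ) :=
  Measure.map (fun x => (x, t₀ - r ^ 2)) (volume.restrict (Metric.closedBall x₀ r)) +
  ((μH[(n - 1 : ℝ)]).restrict (Metric.sphere x₀ r)).prod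
      (volume.restrict (Set.Ioo (t₀ - r ^ 2) t₀))

/-- Definition 4.2: `Ω` is parabolically accessible with constants `δ₀, c₀ > 0`, `N ∈ ℕ`. -/
structure ParAccessible (n : ℕ) (Ω : Set (EuclideanSpace ℝ (Fin n) × ℝ))
    (δ₀ c₀ : ℝ) (N : ℕ) : Prop where
  isOpen : IsOpen Ω
  chain : ∀ δ ∈ Set.Ioo (0:ℝ) δ₀, ∀ p₀ ∈ pint Ω (δ/2) ∩ Q n (1 - δ),
    ∃ p : ℕ → EuclideanSpace ℝ (Fin n) × ℝ, p 0 = p₀ ∧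
      (∀ i : ℕ, 1 ≤ i → i ≤ N → p i ∈ Ω) ∧
      p N ∈ pint Ω δ ∧
      ∀ i < N, (p (i+1)).2 ≤ (p i).2 ∧
        pcylinder n (2 * Real.sqrt ((p i).2 - (p (i+1)).2)) (p i).1 (p i).2 ⊆ Ω ∧
        ‖(p i).1 - (p (i+1)).1‖ ≤ Real.sqrt ((p i).2 - (p (i+1)).2)
  density : ∀ δ ∈ Set.Ioo (0:ℝ) δ₀, ∀ p₀ ∈ Ω ∩ Q n (1 - 2*δ),
    ENNReal.ofReal c₀ * pbSurfaceMeasureCyl n (2*δ) p₀.1 p₀.2 Set.univ ≤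
      pbSurfaceMeasureCyl n (2*δ) p₀.1 p₀.2 (pint Ω δ ∪ Ωᶜ)

/-- The `ℓ²`-norm of the coordinates `x_{m+1},…,x_n` (the `ȳ`-part) of `x ∈ ℝⁿ`. -/
def ybarNorm (n m : ℕ) (x : EuclideanSpace ℝ (Fin n)) : ℝ :=
  Real.sqrt (∑ i : Fin n, if m ≤ (i : ℕ) then x i ^ 2 else 0)

/-- The `ℓ²`-norm of the coordinates `x_1,…,x_m` (the `x̄`-part) of `x ∈ ℝⁿ`. -/
def xbarNorm (n m : ℕ) (x : EuclideanSpace ℝ (Fin n)) : ℝ :=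
  Real.sqrt (∑ i : Fin n, if (i : ℕ) < m then x i ^ 2 else 0)

/-- Definition 4.1: `D_{η,m} = {|ȳ| > η|t|^{1/2}} ∩ {|ȳ| > η|x̄|}`. -/
def Dset (n m : ℕ) (η : ℝ) : Set (EuclideanSpace ℝ (Fin n) × ℝ) :=
  {p | η * Real.sqrt |p.2| < ybarNorm n m p.1 ∧ η * xbarNorm n m p.1 < ybarNorm n m p.1}

/-- The orthogonal projection of `x` onto the `ȳ`-coordinates. -/
def ybarProj (n m : ℕ) : EuclideanSpace ℝ (Fin n) →ₗ[ℝ] EuclideanSpace ℝ (Fin n) where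
  toFun x := WithLp.toLp 2 fun i => if m ≤ (i : ℕ) then x i else 0
  map_add' x y := by ext i; by_cases h : m ≤ (i : ℕ) <;> simp [h]
  map_smul' c x := by ext i; by_cases h : m ≤ (i : ℕ) <;> simp [h]

lemma ybarProj_apply (n m : ℕ) (x : EuclideanSpace ℝ (Fin n)) (i : Fin n) :
    ybarProj n m x i = if m ≤ (i : ℕ) then x i else 0 := rfl

lemma ybarProj_ybarProj (n m : ℕ) (x : EuclideanSpace ℝ (Fin n)) :
    ybarProj n m (ybarProj n m x) = ybarProj n m x := by
  ext i
  by_cases h : m ≤ (i : ℕ) <;> simp [ybarProj_apply, h]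

lemma ybarNorm_eq_norm (n m : ℕ) (x : EuclideanSpace ℝ (Fin n)) :
    ybarNorm n m x = ‖ybarProj n m x‖ := by
  rw [ybarNorm, EuclideanSpace.norm_eq]
  congr 1
  refine Finset.sum_congr rfl fun i _ => ?_
  by_cases h : m ≤ (i : ℕ) <;> simp [ybarProj_apply, h]

lemma xbarNorm_eq_norm (n m : ℕ) (x : EuclideanSpace ℝ (Fin n)) :
    xbarNorm n m x = ‖x - ybarProj n m x‖ := by
  rw [xbarNorm, EuclideanSpace.norm_eq]
  congr 1
  refine Finset.sum_congr rfl fun i _ => ?_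
  by_cases h : m ≤ (i : ℕ)
  · simp [ybarProj_apply, h, not_lt.2 h]
  · simp [ybarProj_apply, h, not_le.1 h]

lemma ybarNorm_sq_add_xbarNorm_sq (n m : ℕ) (x : EuclideanSpace ℝ (Fin n)) :
    ybarNorm n m x ^ 2 + xbarNorm n m x ^ 2 = ‖x‖ ^ 2 := by
  rw [ybarNorm, xbarNorm, Real.sq_sqrt, Real.sq_sqrt, EuclideanSpace.norm_sq_eq,
    ← Finset.sum_add_distrib]
  · refine Finset.sum_congr rfl fun i _ => ?_
    by_cases h : m ≤ (i : ℕ)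
    · simp [h, not_lt.2 h]
    · simp [h, not_le.1 h]
  · exact Finset.sum_nonneg fun i _ => by split_ifs <;> positivity
  · exact Finset.sum_nonneg fun i _ => by split_ifs <;> positivity

lemma ybarNorm_nonneg (n m : ℕ) (x : EuclideanSpace ℝ (Fin n)) : 0 ≤ ybarNorm n m x :=
  Real.sqrt_nonneg _

lemma xbarNorm_nonneg (n m : ℕ) (x : EuclideanSpace ℝ (Fin n)) : 0 ≤ xbarNorm n m x :=
  Real.sqrt_nonneg _

lemma continuous_ybarNorm (n m : ℕ) : Continuous (ybarNorm n m) := by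
  unfold ybarNorm
  refine Real.continuous_sqrt.comp (continuous_finsetSum _ fun i _ => ?_)
  split_ifs <;> fun_prop

lemma continuous_xbarNorm (n m : ℕ) : Continuous (xbarNorm n m) := by
  unfold xbarNorm
  refine Real.continuous_sqrt.comp (continuous_finsetSum _ fun i _ => ?_)
  split_ifs <;> fun_prop

lemma ybarNorm_le_add_sub (n m : ℕ) (x y : EuclideanSpace ℝ (Fin n)) :
    ybarNorm n m x ≤ ybarNorm n m y + ybarNorm n m (x - y) := by
  simp only [ybarNorm_eq_norm, map_sub]
  exact norm_le_norm_add_norm_sub' _ _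

lemma xbarNorm_le_add_sub (n m : ℕ) (x y : EuclideanSpace ℝ (Fin n)) :
    xbarNorm n m y ≤ xbarNorm n m x + xbarNorm n m (x - y) := by
  simp only [xbarNorm_eq_norm, map_sub]
  refine (norm_le_norm_add_norm_sub' _ (x - ybarProj n m x)).trans_eq ?_
  rw [norm_sub_rev (y - _)]
  congr 2
  abel

/-- The outward unit vector `ȳ / |ȳ|` at `x`. -/
def ybarDir (n m : ℕ) (x : EuclideanSpace ℝ (Fin n)) : EuclideanSpace ℝ (Fin n) :=
  (ybarNorm n m x)⁻¹ • ybarProj n m x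

lemma norm_ybarDir {n m : ℕ} {x : EuclideanSpace ℝ (Fin n)} (hx : 0 < ybarNorm n m x) :
    ‖ybarDir n m x‖ = 1 := by
  rw [ybarDir, norm_smul, ← ybarNorm_eq_norm, Real.norm_of_nonneg (by positivity),
    inv_mul_cancel₀ hx.ne']

lemma ybarNorm_add_smul_ybarDir {n m : ℕ} {x : EuclideanSpace ℝ (Fin n)}
    (hx : 0 < ybarNorm n m x) {s : ℝ} (hs : 0 ≤ ybarNorm n m x + s) :
    ybarNorm n m (x + s • ybarDir n m x) = ybarNorm n m x + s := by
  have h : ybarProj n m (x + s • ybarDir n m x)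
      = ((ybarNorm n m x + s) * (ybarNorm n m x)⁻¹) • ybarProj n m x := by
    rw [ybarDir, map_add, map_smul, map_smul, ybarProj_ybarProj, smul_smul, add_mul,
      mul_inv_cancel₀ hx.ne', add_smul, one_smul]
  rw [ybarNorm_eq_norm, h, norm_smul, ← ybarNorm_eq_norm, Real.norm_of_nonneg (by positivity),
    mul_assoc, inv_mul_cancel₀ hx.ne', mul_one]

lemma xbarNorm_add_smul_ybarDir {n m : ℕ} (x : EuclideanSpace ℝ (Fin n)) (s : ℝ) :
    xbarNorm n m (x + s • ybarDir n m x) = xbarNorm n m x := by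
  rw [xbarNorm_eq_norm, xbarNorm_eq_norm, ybarDir, map_add, map_smul, map_smul,
    ybarProj_ybarProj]
  congr 1
  abel

/-- The function `|ȳ| - η max(|t|^{1/2}, |x̄|)`, whose positivity set is `D_{η,m}`. -/
def coneGap (n m : ℕ) (η : ℝ) (p : EuclideanSpace ℝ (Fin n) × ℝ) : ℝ :=
  ybarNorm n m p.1 - η * max (Real.sqrt |p.2|) (xbarNorm n m p.1)

lemma mem_Dset_iff {n m : ℕ} {η : ℝ} (hη : 0 ≤ η) {p : EuclideanSpace ℝ (Fin n) × ℝ} :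
    p ∈ Dset n m η ↔ 0 < coneGap n m η p := by
  rw [coneGap, sub_pos, mul_max_of_nonneg _ _ hη, max_lt_iff]
  rfl

lemma isOpen_Dset (n m : ℕ) (η : ℝ) : IsOpen (Dset n m η) := by
  have hy := (continuous_ybarNorm n m).comp
    (continuous_fst : Continuous (Prod.fst : EuclideanSpace ℝ (Fin n) × ℝ → _))
  have hx := (continuous_xbarNorm n m).comp
    (continuous_fst : Continuous (Prod.fst : EuclideanSpace ℝ (Fin n) × ℝ → _))
  exact (isOpen_lt (by fun_prop) hy).inter (isOpen_lt (continuous_const.mul hx) hy)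

lemma coneGap_le_ybarNorm {n m : ℕ} {η : ℝ} (hη : 0 ≤ η)
    (p : EuclideanSpace ℝ (Fin n) × ℝ) : coneGap n m η p ≤ ybarNorm n m p.1 :=
  sub_le_self _ (mul_nonneg hη (le_max_of_le_left (Real.sqrt_nonneg _)))

lemma sqrt_abs_le_sqrt_abs_add (s t : ℝ) :
    Real.sqrt |t| ≤ Real.sqrt |s| + Real.sqrt |s - t| := by
  rw [Real.sqrt_le_left (by positivity)]
  have h : |t| ≤ |s| + |s - t| := by
    rw [abs_sub_comm]
    linarith [abs_sub_abs_le_abs_sub t s]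
  nlinarith [Real.sq_sqrt (abs_nonneg s), Real.sq_sqrt (abs_nonneg (s - t)),
    Real.sqrt_nonneg |s|, Real.sqrt_nonneg |s - t|]

lemma coneGap_sub_le {n m : ℕ} {η : ℝ} (hη : 0 ≤ η) (p q : EuclideanSpace ℝ (Fin n) × ℝ) :
    coneGap n m η p - (ybarNorm n m (p.1 - q.1)
      + η * max (Real.sqrt |p.2 - q.2|) (xbarNorm n m (p.1 - q.1))) ≤ coneGap n m η q := by
  have h1 := ybarNorm_le_add_sub n m p.1 q.1
  have h2 : max (Real.sqrt |q.2|) (xbarNorm n m q.1) ≤ max (Real.sqrt |p.2|) (xbarNorm n m p.1)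
      + max (Real.sqrt |p.2 - q.2|) (xbarNorm n m (p.1 - q.1)) :=
    max_le
      ((sqrt_abs_le_sqrt_abs_add p.2 q.2).trans (add_le_add (le_max_left _ _) (le_max_left _ _)))
      ((xbarNorm_le_add_sub n m p.1 q.1).trans (add_le_add (le_max_right _ _) (le_max_right _ _)))
  have h3 := mul_le_mul_of_nonneg_left h2 hη
  simp only [coneGap]
  linarith

lemma coneGap_sub_pdist_le {n m : ℕ} {η : ℝ} (hη : η ∈ Ioo (0:ℝ) (1/4))
    (p q : EuclideanSpace ℝ (Fin n) × ℝ) :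
    coneGap n m η p - 17 / 16 * pdist p q ≤ coneGap n m η q := by
  refine le_trans (sub_le_sub_left ?_ _) (coneGap_sub_le hη.1.le p q)
  have hv := ybarNorm_nonneg n m (p.1 - q.1)
  have hsq := ybarNorm_sq_add_xbarNorm_sq n m (p.1 - q.1)
  set v := ybarNorm n m (p.1 - q.1)
  set u := xbarNorm n m (p.1 - q.1)
  have hd : pdist p q ^ 2 = ‖p.1 - q.1‖ ^ 2 + |p.2 - q.2| := Real.sq_sqrt (by positivity)
  have hd0 : 0 ≤ pdist p q := Real.sqrt_nonneg _
  have hs := Real.sq_sqrt (abs_nonneg (p.2 - q.2))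
  set w := max (Real.sqrt |p.2 - q.2|) u
  have hw0 : 0 ≤ w := le_max_of_le_left (Real.sqrt_nonneg _)
  have hw : w ^ 2 ≤ u ^ 2 + |p.2 - q.2| := by
    rcases max_choice (Real.sqrt |p.2 - q.2|) u with h | h
    · rw [show w = _ from h, hs]; nlinarith
    · rw [show w = _ from h]; linarith [abs_nonneg (p.2 - q.2)]
  have h1 : η * w ≤ 1 / 4 * w := mul_le_mul_of_nonneg_right hη.2.le hw0
  have h2 : v + 1 / 4 * w ≤ 17 / 16 * pdist p q := by
    refine abs_le_of_sq_le_sq' ?_ (by positivity) |>.2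
    nlinarith [sq_nonneg (v / 4 - w)]
  linarith

lemma mem_pint_Dset {n m : ℕ} {η : ℝ} (hη : η ∈ Ioo (0:ℝ) (1/4)) {δ : ℝ} (hδ : 0 < δ)
    {p : EuclideanSpace ℝ (Fin n) × ℝ} (hp : 17 / 16 * δ ≤ coneGap n m η p) :
    p ∈ pint (Dset n m η) δ := by
  refine ⟨(mem_Dset_iff hη.1.le).2 (by linarith), fun q hq => ?_⟩
  have hq' : q ∉ Dset n m η := by
    rw [(isOpen_Dset n m η).frontier_eq] at hq
    exact hq.2
  rw [mem_Dset_iff hη.1.le, not_lt] at hq'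
  linarith [coneGap_sub_pdist_le (n := n) (m := m) hη p q]

lemma coneGap_add_smul_ybarDir {n m : ℕ} {η : ℝ} {x : EuclideanSpace ℝ (Fin n)}
    (hx : 0 < ybarNorm n m x) {s : ℝ} (hs : 0 ≤ ybarNorm n m x + s) (t : ℝ) :
    coneGap n m η (x + s • ybarDir n m x, t) = coneGap n m η (x, t) + s := by
  simp only [coneGap, ybarNorm_add_smul_ybarDir hx hs, xbarNorm_add_smul_ybarDir]
  ring

lemma le_coneGap_of_mem_pint {n m : ℕ} {η : ℝ} (hη : 0 ≤ η) {ρ : ℝ}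
    {p : EuclideanSpace ℝ (Fin n) × ℝ} (hp : p ∈ pint (Dset n m η) ρ) :
    ρ ≤ coneGap n m η p := by
  obtain ⟨x, t⟩ := p
  have hg := (mem_Dset_iff hη).1 hp.1
  have hgy : coneGap n m η (x, t) ≤ ybarNorm n m x := coneGap_le_ybarNorm hη (x, t)
  set g := coneGap n m η (x, t)
  have hx : 0 < ybarNorm n m x := hg.trans_le hgy
  have hgap : ∀ s ≤ g, coneGap n m η (x + (-s) • ybarDir n m x, t) = g - s := fun s hs => by
    rw [coneGap_add_smul_ybarDir hx (by linarith)]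
    rfl
  have hcl : (x + (-g) • ybarDir n m x, t) ∈ closure (Dset n m η) := by
    have hc : Continuous fun s : ℝ => (x + (-s) • ybarDir n m x, t) := by fun_prop
    refine map_mem_closure (f := fun s : ℝ => (x + (-s) • ybarDir n m x, t)) (x := g)
      (s := Iio g) hc ?_ fun s hs => ?_
    · rw [closure_Iio]; exact self_mem_Iic
    · rw [mem_Dset_iff hη, hgap s (le_of_lt hs)]
      exact sub_pos.2 hs
  have hfr : (x + (-g) • ybarDir n m x, t) ∈ frontier (Dset n m η) := by
    rw [(isOpen_Dset n m η).frontier_eq]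
    refine ⟨hcl, ?_⟩
    rw [mem_Dset_iff hη, hgap g le_rfl, sub_self]
    exact lt_irrefl _
  refine (hp.2 _ hfr).trans_eq ?_
  simp [pdist, norm_smul, norm_ybarDir hx, abs_of_pos hg, Real.sqrt_sq hg.le]

lemma pcylinder_subset_Dset {n m : ℕ} {η : ℝ} (hη : η ∈ Ioo (0:ℝ) (1/4)) {r : ℝ} (hr : 0 ≤ r)
    {p : EuclideanSpace ℝ (Fin n) × ℝ} (hp : 5 / 4 * r ≤ coneGap n m η p) :
    pcylinder n r p.1 p.2 ⊆ Dset n m η := by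
  rintro ⟨y, s⟩ ⟨hy, hs⟩
  simp only [mem_ball, dist_eq_norm, mem_Ioo] at hy hs
  rw [norm_sub_rev] at hy
  rw [mem_Dset_iff hη.1.le]
  refine lt_of_lt_of_le ?_ (coneGap_sub_le hη.1.le p (y, s))
  have hsq := ybarNorm_sq_add_xbarNorm_sq n m (p.1 - y)
  have hv : ybarNorm n m (p.1 - y) < r :=
    (abs_le_of_sq_le_sq' (by nlinarith [xbarNorm_nonneg n m (p.1 - y)])
      (norm_nonneg _)).2.trans_lt hy
  have hu : xbarNorm n m (p.1 - y) ≤ r :=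
    (abs_le_of_sq_le_sq' (by nlinarith [ybarNorm_nonneg n m (p.1 - y)])
      (norm_nonneg _)).2.trans hy.le
  have ht : Real.sqrt |p.2 - s| ≤ r := by
    rw [Real.sqrt_le_left hr, abs_of_pos (by linarith)]
    linarith
  have h1 := mul_le_mul_of_nonneg_left (max_le ht hu) hη.1.le
  have h2 := mul_le_mul_of_nonneg_right hη.2.le hr
  linarith

lemma coneGap_add_smul_ybarDir_time_ge {n m : ℕ} {η : ℝ} (hη : η ∈ Ioo (0:ℝ) (1/4))
    {x : EuclideanSpace ℝ (Fin n)} (hx : 0 < ybarNorm n m x) {s : ℝ} (hs : 0 ≤ s) {τ : ℝ}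
    (hτ : 0 ≤ τ) (t : ℝ) :
    coneGap n m η (x, t) + s - τ / 4
      ≤ coneGap n m η (x + s • ybarDir n m x, t - τ ^ 2) := by
  have h := coneGap_sub_le (n := n) (m := m) hη.1.le (x + s • ybarDir n m x, t)
    (x + s • ybarDir n m x, t - τ ^ 2)
  rw [coneGap_add_smul_ybarDir hx (by positivity)] at h
  have h0 : ybarNorm n m 0 = 0 := by simp [ybarNorm]
  have h0' : xbarNorm n m 0 = 0 := by simp [xbarNorm]
  simp only [sub_self, h0, h0', sub_sub_cancel, abs_of_nonneg (sq_nonneg τ), Real.sqrt_sq hτ,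
    max_eq_left hτ, zero_add] at h
  nlinarith [hη.2]

lemma exists_chain_Dset {n m : ℕ} {η : ℝ} (hη : η ∈ Ioo (0:ℝ) (1/4)) {δ : ℝ} (hδ : 0 < δ)
    {p₀ : EuclideanSpace ℝ (Fin n) × ℝ} (hp₀ : p₀ ∈ pint (Dset n m η) (δ / 2)) :
    ∃ p : ℕ → EuclideanSpace ℝ (Fin n) × ℝ, p 0 = p₀ ∧
      (∀ i : ℕ, 1 ≤ i → i ≤ 4 → p i ∈ Dset n m η) ∧
      p 4 ∈ pint (Dset n m η) δ ∧
      ∀ i < 4, (p (i+1)).2 ≤ (p i).2 ∧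
        pcylinder n (2 * Real.sqrt ((p i).2 - (p (i+1)).2)) (p i).1 (p i).2 ⊆ Dset n m η ∧
        ‖(p i).1 - (p (i+1)).1‖ ≤ Real.sqrt ((p i).2 - (p (i+1)).2) := by
  obtain ⟨x, t⟩ := p₀
  have hg := le_coneGap_of_mem_pint hη.1.le hp₀
  have hx : 0 < ybarNorm n m x :=
    ((half_pos hδ).trans_le hg).trans_le (coneGap_le_ybarNorm hη.1.le (x, t))
  set g := coneGap n m η (x, t)
  set r := 2 / 5 * g with hrdef
  have hr : 0 < r := by linarith
  let p : ℕ → EuclideanSpace ℝ (Fin n) × ℝ :=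
    fun i => (x + ((i : ℝ) * r) • ybarDir n m x, t - i * r ^ 2)
  have hgap : ∀ i : ℕ, g + (i : ℝ) * r - i * r / 4 ≤ coneGap n m η (p i) := fun i => by
    have hi := Real.sq_sqrt (Nat.cast_nonneg (α := ℝ) i)
    have h := coneGap_add_smul_ybarDir_time_ge hη hx (s := (i : ℝ) * r)
      (τ := Real.sqrt i * r) (by positivity) (by positivity) t
    rw [mul_pow, hi] at h
    have hle : Real.sqrt i ≤ i := by
      rw [Real.sqrt_le_left (by positivity)]
      exact_mod_cast Nat.le_self_pow two_ne_zero i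
    have := mul_le_mul_of_nonneg_right hle hr.le
    change _ ≤ coneGap n m η (x + ((i : ℝ) * r) • ybarDir n m x, t - i * r ^ 2)
    linarith
  have hgap' : ∀ i : ℕ, g ≤ coneGap n m η (p i) := fun i => by
    have := hgap i
    have : 0 ≤ (i : ℝ) * r := by positivity
    linarith
  have htime : ∀ i : ℕ, (p i).2 - (p (i + 1)).2 = r ^ 2 := fun i => by
    simp only [p]; push_cast; ring
  refine ⟨p, by simp [p], fun i _ _ => (mem_Dset_iff hη.1.le).2 (by linarith [hgap' i]),
    mem_pint_Dset hη hδ ?_, fun i _ => ⟨?_, ?_, ?_⟩⟩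
  · have := hgap 4
    push_cast at this
    linarith
  · linarith [htime i, sq_nonneg r]
  · rw [htime, Real.sqrt_sq hr.le]
    exact pcylinder_subset_Dset hη (by positivity) (by linarith [hgap' i])
  · rw [htime, Real.sqrt_sq hr.le]
    have : (p i).1 - (p (i + 1)).1 = (-r) • ybarDir n m x := by
      simp only [p]; push_cast
      rw [add_sub_add_left_eq_sub, ← sub_smul]
      congr 1; ring
    rw [this, norm_smul, norm_ybarDir hx, norm_neg, Real.norm_of_nonneg hr.le, mul_one]

lemma exists_ball_subset_pint_Dset {n m : ℕ} {η : ℝ} (hη : η ∈ Ioo (0:ℝ) (1/4)) {δ : ℝ}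
    (hδ : 0 < δ) {x : EuclideanSpace ℝ (Fin n)} {t : ℝ} (hp : (x, t) ∈ Dset n m η) :
    ∃ z, ball z (δ / 8) ⊆ closedBall x (2 * δ) ∧
      ∀ y ∈ ball z (δ / 8), (y, t - (2 * δ) ^ 2) ∈ pint (Dset n m η) δ := by
  have hg := (mem_Dset_iff hη.1.le).1 hp
  have hx : 0 < ybarNorm n m x := hg.trans_le (coneGap_le_ybarNorm hη.1.le (x, t))
  refine ⟨x + (7 / 4 * δ) • ybarDir n m x, ?_, fun y hy => mem_pint_Dset hη hδ ?_⟩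
  · refine (ball_subset_closedBall).trans (closedBall_subset_closedBall' ?_)
    rw [dist_eq_norm, add_sub_cancel_left, norm_smul, norm_ybarDir hx,
      Real.norm_of_nonneg (by positivity)]
    linarith
  · have h1 := coneGap_add_smul_ybarDir_time_ge hη hx (s := 7 / 4 * δ) (τ := 2 * δ)
      (by positivity) (by positivity) t
    have h2 := coneGap_sub_pdist_le (n := n) (m := m) hη
      (x + (7 / 4 * δ) • ybarDir n m x, t - (2 * δ) ^ 2) (y, t - (2 * δ) ^ 2)
    have h3 : pdist (x + (7 / 4 * δ) • ybarDir n m x, t - (2 * δ) ^ 2) (y, t - (2 * δ) ^ 2)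
        < δ / 8 := by
      rw [mem_ball', dist_eq_norm] at hy
      simpa [pdist] using hy
    linarith

/-- Radial projection to the unit sphere of the affine hyperplane `{x i = s}`. -/
def faceToSphere (k : ℕ) (i : Fin (k + 1)) (s : ℝ) (y : Fin k → ℝ) :
    EuclideanSpace ℝ (Fin (k + 1)) :=
  ‖(WithLp.toLp 2 (i.insertNth s y : Fin (k + 1) → ℝ) : EuclideanSpace ℝ (Fin (k + 1)))‖⁻¹ •
    WithLp.toLp 2 (i.insertNth s y : Fin (k + 1) → ℝ)

lemma contDiff_faceToSphere (k : ℕ) (i : Fin (k + 1)) {s : ℝ} (hs : s ≠ 0) :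
    ContDiff ℝ 1 (faceToSphere k i s) := by
  have h : ContDiff ℝ 1 fun y : Fin k → ℝ =>
      (WithLp.toLp 2 (i.insertNth s y : Fin (k + 1) → ℝ) : EuclideanSpace ℝ (Fin (k + 1))) := by
    rw [contDiff_euclidean]
    intro j
    refine Fin.succAboveCases i ?_ (fun j => ?_) j
    · simpa using contDiff_const
    · simpa using contDiff_apply ℝ ℝ j
  have h0 : ∀ y : Fin k → ℝ,
      (WithLp.toLp 2 (i.insertNth s y : Fin (k + 1) → ℝ) : EuclideanSpace ℝ (Fin (k + 1))) ≠ 0 :=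
    fun y hy => hs (by simpa using congrArg (fun v => v i) hy)
  exact ((h.norm ℝ h0).inv fun y => norm_ne_zero_iff.2 (h0 y)).smul h

lemma hausdorffMeasure_faceToSphere_image_lt_top (k : ℕ) (i : Fin (k + 1)) {s : ℝ}
    (hs : s ≠ 0) : μH[(k : ℝ)] (faceToSphere k i s '' Icc (-1) 1) < ⊤ := by
  obtain ⟨K, hK⟩ := (contDiff_faceToSphere k i hs).contDiffOn.exists_lipschitzOnWith one_ne_zero
    (convex_Icc (-1 : Fin k → ℝ) 1) isCompact_Icc
  refine (hK.hausdorffMeasure_image_le k.cast_nonneg).trans_lt (ENNReal.mul_lt_top ?_ ?_)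
  · exact ENNReal.rpow_lt_top_of_nonneg k.cast_nonneg ENNReal.coe_ne_top
  · have := hausdorffMeasure_pi_real (ι := Fin k)
    rw [Fintype.card_fin] at this
    rw [this]
    exact isCompact_Icc.measure_lt_top

lemma sphere_subset_iUnion_faceToSphere (k : ℕ) :
    sphere (0 : EuclideanSpace ℝ (Fin (k + 1))) 1 ⊆
      ⋃ i : Fin (k + 1), faceToSphere k i 1 '' Icc (-1) 1 ∪ faceToSphere k i (-1) '' Icc (-1) 1 := by
  intro z hz
  rw [mem_sphere_zero_iff_norm] at hz
  obtain ⟨i, hi⟩ := Finite.exists_max fun j => |z j|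
  have hzi : 0 < |z i| := by
    by_contra! h
    have : z = 0 := by
      ext j
      exact abs_nonpos_iff.1 ((hi j).trans h)
    simp [this] at hz
  have key : ∀ s : ℝ, z i / |z i| = s →
      z ∈ faceToSphere k i s '' Icc (-1) 1 := by
    intro s hs
    refine ⟨fun j => z (i.succAbove j) / |z i|, ?_, ?_⟩
    · rw [mem_Icc, Pi.le_def, Pi.le_def, ← forall_and]
      intro j
      simp only [Pi.neg_apply, Pi.one_apply, ← abs_le, abs_div, abs_abs]
      exact div_le_one_of_le₀ (hi _) hzi.le
    · have : (WithLp.toLp 2 (i.insertNth s (fun j => z (i.succAbove j) / |z i|) :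
          Fin (k + 1) → ℝ) : EuclideanSpace ℝ (Fin (k + 1))) = |z i|⁻¹ • z := by
        ext j
        refine Fin.succAboveCases i ?_ (fun j => ?_) j
        · simp [← hs, div_eq_inv_mul]
        · simp [div_eq_inv_mul]
      rw [faceToSphere, this, norm_smul, hz, mul_one, norm_inv, Real.norm_eq_abs, abs_abs, inv_inv,
        smul_smul, mul_inv_cancel₀ hzi.ne', one_smul]
  refine mem_iUnion.2 ⟨i, ?_⟩
  rcases abs_choice (z i) with h | h
  · exact Or.inl (key 1 (by rw [h]; exact div_self (abs_pos.1 hzi)))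
  · exact Or.inr (key (-1) (by rw [h, div_neg, div_self (abs_pos.1 hzi)]))

lemma hausdorffMeasure_unitSphere_lt_top (k : ℕ) :
    μH[(k : ℝ)] (sphere (0 : EuclideanSpace ℝ (Fin (k + 1))) 1) < ⊤ := by
  refine (measure_mono (sphere_subset_iUnion_faceToSphere k)).trans_lt ?_
  refine (measure_iUnion_fintype_le _ _).trans_lt (ENNReal.sum_lt_top.2 fun i _ => ?_)
  exact measure_union_lt_top (hausdorffMeasure_faceToSphere_image_lt_top k i one_ne_zero)
    (hausdorffMeasure_faceToSphere_image_lt_top k i (by norm_num))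

lemma hausdorffMeasure_sphere_le {E : Type*} [NormedAddCommGroup E] [NormedSpace ℝ E]
    [MeasurableSpace E] [BorelSpace E] {d : ℝ} (hd : 0 ≤ d) (x : E) {r : ℝ} (hr : 0 < r) :
    μH[d] (sphere x r) ≤ ENNReal.ofReal r ^ d * μH[d] (sphere (0 : E) 1) := by
  have hL : LipschitzWith r.toNNReal fun z : E => x + r • z :=
    LipschitzWith.of_dist_le_mul fun y z => by
      rw [dist_add_left, dist_smul₀, Real.norm_of_nonneg hr.le, Real.coe_toNNReal _ hr.le]
  refine (measure_mono fun y hy => ?_).trans (hL.hausdorffMeasure_image_le hd (sphere 0 1))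
  rw [mem_sphere_iff_norm] at hy
  refine ⟨r⁻¹ • (y - x), ?_, ?_⟩
  · rw [mem_sphere_zero_iff_norm, norm_smul, hy, norm_inv, Real.norm_of_nonneg hr.le,
      inv_mul_cancel₀ hr.ne']
  · simp [smul_smul, hr.ne']

lemma pbSurfaceMeasureCyl_univ_le {k : ℕ} {r : ℝ} (hr : r ∈ Ioc (0:ℝ) 1)
    (x : EuclideanSpace ℝ (Fin (k + 1))) (t : ℝ) :
    pbSurfaceMeasureCyl (k + 1) r x t univ ≤ ENNReal.ofReal r ^ (k + 1) *
      (volume (ball (0 : EuclideanSpace ℝ (Fin (k + 1))) 1)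
        + μH[(k : ℝ)] (sphere (0 : EuclideanSpace ℝ (Fin (k + 1))) 1)) := by
  have hdim : (((k + 1 : ℕ) : ℝ) - 1) = k := by push_cast; ring
  rw [pbSurfaceMeasureCyl, hdim, Measure.add_apply, Measure.map_apply (by fun_prop) .univ,
    preimage_univ, Measure.restrict_apply_univ, ← univ_prod_univ, Measure.prod_prod,
    Measure.restrict_apply_univ, Measure.restrict_apply_univ, Real.volume_Ioo, sub_sub_cancel,
    Measure.addHaar_closedBall _ _ hr.1.le, finrank_euclideanSpace_fin, mul_add,
    ENNReal.ofReal_pow hr.1.le, ENNReal.ofReal_pow hr.1.le]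
  refine add_le_add_right ?_ _
  set H := μH[(k : ℝ)] (sphere (0 : EuclideanSpace ℝ (Fin (k + 1))) 1)
  have h1 : ENNReal.ofReal r ≤ 1 := ENNReal.ofReal_le_one.2 hr.2
  calc _ ≤ ENNReal.ofReal r ^ (k : ℝ) * H * ENNReal.ofReal r ^ 2 := by
        gcongr
        exact hausdorffMeasure_sphere_le k.cast_nonneg x hr.1
    _ = ENNReal.ofReal r * (ENNReal.ofReal r ^ (k + 1) * H) := by
        rw [ENNReal.rpow_natCast]; ring
    _ ≤ _ := mul_le_of_le_one_left zero_le h1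

lemma volume_le_pbSurfaceMeasureCyl {n : ℕ} {r : ℝ} {x : EuclideanSpace ℝ (Fin n)} {t : ℝ}
    {B : Set (EuclideanSpace ℝ (Fin n))} {S : Set (EuclideanSpace ℝ (Fin n) × ℝ)}
    (hB : B ⊆ closedBall x r) (hS : ∀ y ∈ B, (y, t - r ^ 2) ∈ S) :
    volume B ≤ pbSurfaceMeasureCyl n r x t S := by
  rw [pbSurfaceMeasureCyl, Measure.add_apply]
  refine le_add_right (le_trans ?_ (Measure.le_map_apply (by fun_prop) S))
  exact (measure_mono (subset_inter hS hB)).trans (Measure.le_restrict_apply _ _)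

/-- **Lemma 4.6.** For every `η ∈ (0,1/4)` and `m ∈ {0,…,n-2}`, the domain `D_{η,m}` is
parabolically accessible with constants `N = 4`, `δ₀ = 1/2`, and a constant `c₀ > 0`
depending only on the dimension (in particular, not on `η`). -/
theorem Dset_parabolically_accessible
    (n : ℕ) (hn : 2 ≤ n) :
    ∃ c₀ > (0:ℝ), ∀ η ∈ Set.Ioo (0:ℝ) (1/4), ∀ m : ℕ, m ≤ n - 2 →
      ParAccessible n (Dset n m η) (1/2) c₀ 4 := by
  obtain ⟨k, rfl⟩ : ∃ k, n = k + 1 := ⟨n - 1, by omega⟩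
  set V := volume (ball (0 : EuclideanSpace ℝ (Fin (k + 1))) 1)
  set T := V + μH[(k : ℝ)] (sphere (0 : EuclideanSpace ℝ (Fin (k + 1))) 1)
  have hV0 : V ≠ 0 := (measure_ball_pos _ _ one_pos).ne'
  have hVtop : V ≠ ⊤ := measure_ball_lt_top.ne
  have hTtop : T ≠ ⊤ := ENNReal.add_ne_top.2 ⟨hVtop, (hausdorffMeasure_unitSphere_lt_top k).ne⟩
  have hT0 : T ≠ 0 := fun h => hV0 (add_eq_zero.1 h).1
  have hc : ENNReal.ofReal (1 / 16) ^ (k + 1) * (V / T) ≠ ⊤ :=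
    ENNReal.mul_ne_top (ENNReal.pow_ne_top ENNReal.ofReal_ne_top) (ENNReal.div_ne_top hVtop hT0)
  refine ⟨(ENNReal.ofReal (1 / 16) ^ (k + 1) * (V / T)).toReal,
    ENNReal.toReal_pos (mul_ne_zero (pow_ne_zero _ (by simp))
      (ENNReal.div_ne_zero.2 ⟨hV0, hTtop⟩)) hc, fun η hη m _ => ⟨isOpen_Dset _ _ _, ?_, ?_⟩⟩
  · exact fun δ hδ p₀ hp₀ => exists_chain_Dset hη hδ.1 hp₀.1
  · rintro δ hδ ⟨x, t⟩ ⟨hp, -⟩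
    obtain ⟨z, hz, hzD⟩ := exists_ball_subset_pint_Dset hη hδ.1 hp
    rw [ENNReal.ofReal_toReal hc]
    calc _ ≤ ENNReal.ofReal (1 / 16) ^ (k + 1) * (V / T)
          * (ENNReal.ofReal (2 * δ) ^ (k + 1) * T) := by
          gcongr
          exact pbSurfaceMeasureCyl_univ_le ⟨by linarith [hδ.1], by linarith [hδ.2]⟩ x t
      _ = (ENNReal.ofReal (1 / 16) * ENNReal.ofReal (2 * δ)) ^ (k + 1) * (V / T * T) := by
          rw [mul_pow]; ring
      _ = ENNReal.ofReal (δ / 8) ^ (k + 1) * V := by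
          rw [ENNReal.div_mul_cancel hT0 hTtop, ← ENNReal.ofReal_mul (by norm_num)]
          congr 3
          ring
      _ = volume (ball z (δ / 8)) := by
          rw [Measure.addHaar_ball _ _ (by linarith [hδ.1]), finrank_euclideanSpace_fin,
            ENNReal.ofReal_pow (by linarith [hδ.1])]
      _ ≤ _ := volume_le_pbSurfaceMeasureCyl hz fun y hy => Or.inl (hzD y hy)

end
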